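/- Let ρ be the Rayleigh distribution. Let P be the product measure 𝔻 ⊗ Unif[0,1] ⊗ Unif[0,1] ⊗ ρ ⊗ ρ ⊗ ρ on ℝ² × [0,1] × [0,1] × ℝ³, where 𝔻 is the Dirichlet(1/2,1/2,1/2) distribution. For a point ((x,y), u, v, (d₁,d₂,d₃)), set δ₁ = x, δ₂ = y, δ₃ = 1−x−y, let I₁ = [0, δ₁), I₂ = [δ₁, δ₁+δ₂), I₃ = [δ₁+δ₂, 1], and define Φ = Σ_{k=1}^{3} √δ_k · d_k · 1{ u ∈ I_k or v ∈ I_k }. Then the pushforward of P under Φ equals ρ. That is, the Rayleigh distribution is a fixed point of the smoothing transform 𝔉_sm: if D₁, D₂, D₃ are i.i.d. Rayleigh, (Δ₁,Δ₂,Δ₃) ~ Dirichlet(1/2,1/2,1/2) independent of them, and conditionally on Δ, (P₁,P₂,P₃) ~ Multinomial(2; Δ₁,Δ₂,Δ₃), then √Δ₁ D₁ 1{P₁>0} + √Δ₂ D₂ 1{P₂>0} + √Δ₃ D₃ 1{P₃>0} has the Rayleigh distribution. -/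

import Mathlib

open MeasureTheory Real Set

/-- The Rayleigh distribution: density `x e^(−x²/2)` on `(0,∞)` w.r.t. Lebesgue. -/
noncomputable def rayleigh : Measure ℝ :=
  volume.withDensity fun x =>
    ENNReal.ofReal (Set.indicator (Set.Ioi (0 : ℝ)) (fun y => y * Real.exp (-y ^ 2 / 2)) x)

/-- The `Dirichlet(1/2,1/2,1/2)` distribution on `ℝ²`: density
`(2π)⁻¹ (xy(1−x−y))^(−1/2)` on the open simplex w.r.t. 2-dim Lebesgue. -/
noncomputable def dirichletHalf : Measure (ℝ × ℝ) :=
  volume.withDensity fun p =>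
    ENNReal.ofReal
      (Set.indicator {q : ℝ × ℝ | 0 < q.1 ∧ 0 < q.2 ∧ q.1 + q.2 < 1}
        (fun q => (2 * π)⁻¹ * (q.1 * q.2 * (1 - q.1 - q.2)) ^ (-(1 / 2) : ℝ)) p)

/-- The uniform distribution on `[0,1]`. -/
noncomputable def unif01 : Measure ℝ := volume.restrict (Set.Icc (0 : ℝ) 1)

/-- The map `((x,y),u,v,(d₁,d₂,d₃)) ↦ Σₖ √δₖ · dₖ · 1{u ∈ Iₖ or v ∈ Iₖ}` where
`δ₁ = x`, `δ₂ = y`, `δ₃ = 1−x−y`, `I₁ = [0,δ₁)`, `I₂ = [δ₁,δ₁+δ₂)`, `I₃ = [δ₁+δ₂,1]`. -/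
noncomputable def smoothingMap : (ℝ × ℝ) × ℝ × ℝ × ℝ × ℝ × ℝ → ℝ := fun q =>
  let δ₁ := q.1.1
  let δ₂ := q.1.2
  let δ₃ := 1 - q.1.1 - q.1.2
  let u := q.2.1
  let v := q.2.2.1
  let d₁ := q.2.2.2.1
  let d₂ := q.2.2.2.2.1
  let d₃ := q.2.2.2.2.2
  Real.sqrt δ₁ * d₁ * (if u ∈ Set.Ico (0 : ℝ) δ₁ ∨ v ∈ Set.Ico (0 : ℝ) δ₁ then 1 else 0) +
  Real.sqrt δ₂ * d₂ * (if u ∈ Set.Ico δ₁ (δ₁ + δ₂) ∨ v ∈ Set.Ico δ₁ (δ₁ + δ₂) then 1 else 0) +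
  Real.sqrt δ₃ * d₃ * (if u ∈ Set.Icc (δ₁ + δ₂) 1 ∨ v ∈ Set.Icc (δ₁ + δ₂) 1 then 1 else 0)

/-- The smoothing transform `𝔉_sm` associated with the BCRT: the law of
`Σₖ √Δₖ Dₖ 1{Pₖ>0}` where `(Δ₁,Δ₂,Δ₃) ~ Dirichlet(1/2,1/2,1/2)`, `D₁,D₂,D₃` i.i.d.
with law `μ`, and, conditionally on `Δ`, `(P₁,P₂,P₃) ~ Multinomial(2;Δ₁,Δ₂,Δ₃)`,
realised via two independent uniforms `u,v` on `[0,1]`. -/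
noncomputable def Fsm (μ : Measure ℝ) : Measure ℝ :=
  Measure.map smoothingMap
    (dirichletHalf.prod (unif01.prod (unif01.prod (μ.prod (μ.prod μ)))))


open ProbabilityTheory ENNReal

lemma meas_dens : Measurable (fun x : ℝ => ENNReal.ofReal (Set.indicator (Set.Ioi (0 : ℝ)) (fun y => y * Real.exp (-y ^ 2 / 2)) x)) := by
  apply Measurable.ennreal_ofReal
  exact Measurable.indicator (by fun_prop) measurableSet_Ioi

lemma rayleigh_ae_pos : ∀ᵐ x ∂rayleigh, 0 < x := by
  unfold rayleigh
  rw [ae_withDensity_iff meas_dens]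
  filter_upwards with x hx
  by_contra h
  apply hx
  rw [Set.indicator_of_notMem (by simpa using h)]
  simp

lemma lintegral_rayleigh (f : ℝ → ℝ≥0∞) (hf : Measurable f) :
    ∫⁻ x, f x ∂rayleigh =
      ∫⁻ x in Ioi (0:ℝ), ENNReal.ofReal (x * Real.exp (-x ^ 2 / 2)) * f x := by
  unfold rayleigh
  rw [lintegral_withDensity_eq_lintegral_mul _ meas_dens hf,
    ← lintegral_indicator measurableSet_Ioi]
  apply lintegral_congr
  intro x
  by_cases h : x ∈ Ioi (0:ℝ) <;> simp [h]

noncomputable def Ray (n : ℕ) : ℝ := 2 ^ ((n:ℝ)/2) * Real.Gamma (n/2 + 1)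

lemma Ray_pos (n : ℕ) : 0 < Ray n := by
  unfold Ray
  have := Real.Gamma_pos_of_pos (s := (n:ℝ)/2+1) (by positivity)
  positivity

lemma rayleigh_moment (n : ℕ) :
    ∫⁻ x, ENNReal.ofReal x ^ n ∂rayleigh = ENNReal.ofReal (Ray n) := by
  rw [lintegral_rayleigh _ (by fun_prop)]
  have h1 : ∫⁻ x in Ioi (0:ℝ), ENNReal.ofReal (x * Real.exp (-x ^ 2 / 2)) * ENNReal.ofReal x ^ n
      = ∫⁻ x in Ioi (0:ℝ), ENNReal.ofReal (x ^ ((n:ℝ)+1) * Real.exp (-(1/2) * x ^ (2:ℝ))) := by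
    apply setLIntegral_congr_fun measurableSet_Ioi
    intro x hx
    have hx : 0 < x := hx
    simp only
    rw [← ENNReal.ofReal_pow hx.le, ← ENNReal.ofReal_mul (by positivity)]
    congr 1
    rw [Real.rpow_add hx, Real.rpow_natCast, Real.rpow_one, Real.rpow_two]
    rw [show -(1/2) * x^2 = -x^2/2 by ring]
    ring
  rw [h1, ← ofReal_integral_eq_lintegral_ofReal]
  · rw [integral_rpow_mul_exp_neg_mul_rpow (by norm_num) (by have : (0:ℝ) ≤ n := by positivity
                                                             linarith) (by norm_num)]
    congr 1
    unfold Ray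
    rw [one_div, Real.inv_rpow (by norm_num), ← Real.rpow_neg (by norm_num)]
    rw [show -(-((n:ℝ)+1+1)/2) = (n:ℝ)/2 + 1 by ring, show ((n:ℝ)+1+1)/2 = (n:ℝ)/2 + 1 by ring,
      Real.rpow_add (by norm_num), Real.rpow_one]
    ring
  · exact integrableOn_rpow_mul_exp_neg_mul_rpow (by have : (0:ℝ) ≤ n := by positivity
                                                     linarith) (by norm_num) (by norm_num)
  · filter_upwards [ae_restrict_mem measurableSet_Ioi] with x hx
    have hx : 0 < x := hx
    simp only [Pi.zero_apply]
    positivity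

instance : IsProbabilityMeasure rayleigh := ⟨by
  have := rayleigh_moment 0
  simpa [Ray] using this⟩

lemma lintegral_exp_series (μ : Measure ℝ) (h : ∀ᵐ x ∂μ, 0 ≤ x) (t : ℝ) (ht : 0 ≤ t) :
    ∫⁻ x, ENNReal.ofReal (Real.exp (t * x)) ∂μ =
      ∑' n : ℕ, ENNReal.ofReal (t ^ n / n.factorial) * ∫⁻ x, ENNReal.ofReal x ^ n ∂μ := by
  have : ∀ᵐ x ∂μ, ENNReal.ofReal (Real.exp (t * x)) =
      ∑' n : ℕ, ENNReal.ofReal (t ^ n / n.factorial) * ENNReal.ofReal x ^ n := by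
    filter_upwards [h] with x hx
    have hs := NormedSpace.expSeries_div_hasSum_exp (t * x)
    rw [← Real.exp_eq_exp_ℝ] at hs
    rw [← hs.tsum_eq, ENNReal.ofReal_tsum_of_nonneg (fun n => by positivity) hs.summable]
    congr 1
    ext n
    rw [← ENNReal.ofReal_pow hx, ← ENNReal.ofReal_mul (by positivity)]
    congr 1
    rw [mul_pow]; ring
  rw [lintegral_congr_ae this, lintegral_tsum (fun n => by fun_prop)]
  congr 1
  ext n
  rw [lintegral_const_mul _ (by fun_prop)]

lemma rayleigh_exp_lt_top (t : ℝ) :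
    ∫⁻ x, ENNReal.ofReal (Real.exp (t * x)) ∂rayleigh < ∞ := by
  rw [lintegral_rayleigh _ (by fun_prop)]
  have hi : Integrable (fun x : ℝ => Real.exp (t^2) * (x * Real.exp (-(1/4) * x^2))) :=
    (integrable_mul_exp_neg_mul_sq (by norm_num)).const_mul _
  refine lt_of_le_of_lt ?_ (hi.restrict (s := Ioi 0)).lintegral_lt_top
  apply setLIntegral_mono' measurableSet_Ioi
  intro x hx
  have hx : 0 < x := hx
  rw [← ENNReal.ofReal_mul (by positivity)]
  apply ENNReal.ofReal_le_ofReal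
  rw [mul_assoc, ← Real.exp_add, mul_left_comm, ← Real.exp_add]
  apply mul_le_mul_of_nonneg_left _ hx.le
  rw [Real.exp_le_exp]
  nlinarith [sq_nonneg (t - x/2)]

lemma rayleigh_determinate (μ : Measure ℝ) (h : ∀ᵐ x ∂μ, 0 ≤ x)
    (hm : ∀ n : ℕ, ∫⁻ x, ENNReal.ofReal x ^ n ∂μ = ∫⁻ x, ENNReal.ofReal x ^ n ∂rayleigh) :
    μ = rayleigh := by
  have hp : IsProbabilityMeasure μ := ⟨by
    have := hm 0
    simpa using this⟩
  have hexp : ∀ t : ℝ, 0 ≤ t → ∫⁻ x, ENNReal.ofReal (Real.exp (t * x)) ∂μ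
      = ∫⁻ x, ENNReal.ofReal (Real.exp (t * x)) ∂rayleigh := by
    intro t ht
    rw [lintegral_exp_series μ h t ht,
      lintegral_exp_series rayleigh (rayleigh_ae_pos.mono fun _ h => h.le) t ht]
    simp_rw [hm]
  have hmgf : ∀ t : ℝ, 0 ≤ t → mgf id μ t = mgf id rayleigh t := by
    intro t ht
    unfold mgf
    rw [integral_eq_lintegral_of_nonneg_ae (by filter_upwards with x; positivity) (by fun_prop),
      integral_eq_lintegral_of_nonneg_ae (by filter_upwards with x; positivity) (by fun_prop)]
    simp only [id]
    rw [hexp t ht]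
  have hint : ∀ t : ℝ, Integrable (fun x => Real.exp (t * x)) μ := by
    have h0 : ∀ t : ℝ, 0 ≤ t → Integrable (fun x => Real.exp (t * x)) μ := by
      intro t ht
      refine ⟨by fun_prop, ?_⟩
      rw [hasFiniteIntegral_iff_ofReal (by filter_upwards with x; positivity), hexp t ht]
      exact rayleigh_exp_lt_top t
    intro t
    refine (h0 |t| (abs_nonneg _)).mono' (by fun_prop) ?_
    filter_upwards [h] with x hx
    rw [Real.norm_of_nonneg (by positivity)]
    gcongr
    exact le_abs_self t
  have hintr : ∀ t : ℝ, Integrable (fun x => Real.exp (t * x)) rayleigh := by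
    intro t
    refine ⟨by fun_prop, ?_⟩
    rw [hasFiniteIntegral_iff_ofReal (by filter_upwards with x; positivity)]
    exact rayleigh_exp_lt_top t
  have s1 : integrableExpSet id μ = univ := by
    ext t; simpa [integrableExpSet] using hint t
  have s2 : integrableExpSet id rayleigh = univ := by
    ext t; simpa [integrableExpSet] using hintr t
  have a1 : AnalyticOnNhd ℝ (mgf id μ) univ := by
    have := analyticOnNhd_mgf (X := id) (μ := μ)
    rwa [s1, interior_univ] at this
  have a2 : AnalyticOnNhd ℝ (mgf id rayleigh) univ := by
    have := analyticOnNhd_mgf (X := id) (μ := rayleigh)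
    rwa [s2, interior_univ] at this
  have hmm : mgf id μ = mgf id rayleigh := by
    apply a1.eq_of_eventuallyEq a2 (z₀ := 1)
    filter_upwards [Ioi_mem_nhds (show (0:ℝ) < 1 by norm_num)] with t ht
    exact hmgf t (le_of_lt ht)
  apply Measure.ext_of_complexMGF_id_eq
  have := eqOn_complexMGF_of_mgf hmm
  rw [s1] at this
  ext z
  exact this (by simp)

lemma beta_lintegral {a b : ℝ} (ha : 0 < a) (hb : 0 < b) :
    ∫⁻ x in Ioo (0:ℝ) 1, ENNReal.ofReal (x ^ (a - 1) * (1 - x) ^ (b - 1)) =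
      ENNReal.ofReal (beta a b) := by
  have h := lintegral_betaPDF_eq_one ha hb
  have hB := beta_pos ha hb
  rw [lintegral_betaPDF] at h
  simp_rw [mul_assoc] at h
  have h2 : ∫⁻ x in Ioo (0:ℝ) 1, ENNReal.ofReal (1 / beta a b * (x ^ (a - 1) * (1 - x) ^ (b - 1)))
    = ENNReal.ofReal (1 / beta a b) *
      ∫⁻ x in Ioo (0:ℝ) 1, ENNReal.ofReal (x ^ (a - 1) * (1 - x) ^ (b - 1)) := by
    rw [← lintegral_const_mul _ (by fun_prop)]
    congr 1
    ext x
    rw [ENNReal.ofReal_mul (by positivity)]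
  rw [h2] at h
  calc _ = ENNReal.ofReal (beta a b) * (ENNReal.ofReal (1 / beta a b) *
      ∫⁻ x in Ioo (0:ℝ) 1, ENNReal.ofReal (x ^ (a - 1) * (1 - x) ^ (b - 1))) := by
        rw [← mul_assoc, ← ENNReal.ofReal_mul hB.le, mul_one_div_cancel hB.ne']
        simp
    _ = _ := by rw [h, mul_one]

lemma beta_lintegral_scaled {a b s : ℝ} (ha : 0 < a) (hb : 0 < b) (hs : 0 < s) :
    ∫⁻ x in Ioo (0:ℝ) s, ENNReal.ofReal (x ^ (a - 1) * (s - x) ^ (b - 1)) =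
      ENNReal.ofReal (s ^ (a + b - 1) * beta a b) := by
  have him : (fun x => s * x) '' Ioo (0:ℝ) 1 = Ioo 0 s := by
    have := Set.image_mul_left_Ioo (a := s) hs 0 1
    simpa using this
  rw [← him, lintegral_image_eq_lintegral_abs_deriv_mul measurableSet_Ioo
    (f' := fun _ => s)
    (fun x _ => by simpa using ((hasDerivAt_id x).const_mul s).hasDerivWithinAt)
    (fun x _ y _ h => mul_left_cancel₀ hs.ne' h)]
  rw [ENNReal.ofReal_mul (by positivity), ← beta_lintegral ha hb,
    ← lintegral_const_mul _ (by fun_prop)]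
  apply setLIntegral_congr_fun measurableSet_Ioo
  intro x hx
  have h1 : 0 < x := hx.1
  have h2 : 0 < 1 - x := by linarith [hx.2]
  simp only
  rw [abs_of_pos hs, ← ENNReal.ofReal_mul hs.le, ← ENNReal.ofReal_mul (by positivity)]
  congr 1
  rw [show s - s * x = s * (1 - x) by ring, Real.mul_rpow hs.le h1.le, Real.mul_rpow hs.le h2.le,
    show a + b - 1 = 1 + (a - 1) + (b - 1) by ring, Real.rpow_add hs, Real.rpow_add hs,
    Real.rpow_one]
  ring

/-- Mixed moments of the Dirichlet(1/2,1/2,1/2) distribution. -/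
noncomputable def DM (a b c : ℝ) : ℝ :=
  (2 * π)⁻¹ * (Real.Gamma (a + 1/2) * Real.Gamma (b + 1/2) * Real.Gamma (c + 1/2)
    / Real.Gamma (a + b + c + 3/2))

lemma DM_pos {a b c : ℝ} (ha : 0 ≤ a) (hb : 0 ≤ b) (hc : 0 ≤ c) : 0 < DM a b c := by
  unfold DM
  have h1 := Real.Gamma_pos_of_pos (s := a + 1/2) (by positivity)
  have h2 := Real.Gamma_pos_of_pos (s := b + 1/2) (by positivity)
  have h3 := Real.Gamma_pos_of_pos (s := c + 1/2) (by positivity)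
  have h4 := Real.Gamma_pos_of_pos (s := a + b + c + 3/2) (by positivity)
  positivity

lemma measurableSet_simplex :
    MeasurableSet {q : ℝ × ℝ | 0 < q.1 ∧ 0 < q.2 ∧ q.1 + q.2 < 1} := by
  have h1 : MeasurableSet {q : ℝ × ℝ | 0 < q.1} := measurableSet_lt (by fun_prop) (by fun_prop)
  have h2 : MeasurableSet {q : ℝ × ℝ | 0 < q.2} := measurableSet_lt (by fun_prop) (by fun_prop)
  have h3 : MeasurableSet {q : ℝ × ℝ | q.1 + q.2 < 1} :=
    measurableSet_lt (by fun_prop) (by fun_prop)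
  exact h1.inter (h2.inter h3)

lemma meas_dir_dens : Measurable (fun p : ℝ × ℝ => ENNReal.ofReal
      (Set.indicator {q : ℝ × ℝ | 0 < q.1 ∧ 0 < q.2 ∧ q.1 + q.2 < 1}
        (fun q => (2 * π)⁻¹ * (q.1 * q.2 * (1 - q.1 - q.2)) ^ (-(1 / 2) : ℝ)) p)) := by
  apply Measurable.ennreal_ofReal
  exact Measurable.indicator (by fun_prop) measurableSet_simplex

lemma dir_ae : ∀ᵐ p ∂dirichletHalf, 0 < p.1 ∧ 0 < p.2 ∧ p.1 + p.2 < 1 := by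
  unfold dirichletHalf
  rw [ae_withDensity_iff meas_dir_dens]
  filter_upwards with x hx
  by_contra h
  apply hx
  rw [Set.indicator_of_notMem (by simpa using h)]
  simp

lemma dir_moment {a b c : ℝ} (ha : 0 ≤ a) (hb : 0 ≤ b) (hc : 0 ≤ c) :
    ∫⁻ p, ENNReal.ofReal (p.1 ^ a * p.2 ^ b * (1 - p.1 - p.2) ^ c) ∂dirichletHalf =
      ENNReal.ofReal (DM a b c) := by
  unfold dirichletHalf
  have hm : Measurable (fun p : ℝ × ℝ =>
    ENNReal.ofReal (p.1 ^ a * p.2 ^ b * (1 - p.1 - p.2) ^ c)) := by fun_prop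
  rw [lintegral_withDensity_eq_lintegral_mul _ meas_dir_dens hm, Measure.volume_eq_prod,
    lintegral_prod _ (meas_dir_dens.mul hm).aemeasurable]
  have key : ∀ x : ℝ, (∫⁻ y : ℝ, ((fun p : ℝ × ℝ => ENNReal.ofReal
      (Set.indicator {q : ℝ × ℝ | 0 < q.1 ∧ 0 < q.2 ∧ q.1 + q.2 < 1}
        (fun q => (2 * π)⁻¹ * (q.1 * q.2 * (1 - q.1 - q.2)) ^ (-(1 / 2) : ℝ)) p)) *
        (fun p : ℝ × ℝ =>
    ENNReal.ofReal (p.1 ^ a * p.2 ^ b * (1 - p.1 - p.2) ^ c))) (x, y)) =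
    (Ioo (0:ℝ) 1).indicator (fun x => ENNReal.ofReal ((2 * π)⁻¹ * beta (b + 1/2) (c + 1/2)) *
      ENNReal.ofReal (x ^ ((a + 1/2) - 1) * (1 - x) ^ ((b + c + 1) - 1))) x := by
    intro x
    by_cases hx : x ∈ Ioo (0:ℝ) 1
    · have hx0 : 0 < x := hx.1
      have hx1 : 0 < 1 - x := by linarith [hx.2]
      have hB := beta_pos (show 0 < b + 1/2 by positivity) (show 0 < c + 1/2 by positivity)
      rw [Set.indicator_of_mem hx]
      have h1 := beta_lintegral_scaled (show 0 < b + 1/2 by positivity)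
        (show 0 < c + 1/2 by positivity) hx1
      have h2 : ∀ y : ℝ, ((fun p : ℝ × ℝ => ENNReal.ofReal
      (Set.indicator {q : ℝ × ℝ | 0 < q.1 ∧ 0 < q.2 ∧ q.1 + q.2 < 1}
        (fun q => (2 * π)⁻¹ * (q.1 * q.2 * (1 - q.1 - q.2)) ^ (-(1 / 2) : ℝ)) p)) *
        (fun p : ℝ × ℝ =>
          ENNReal.ofReal (p.1 ^ a * p.2 ^ b * (1 - p.1 - p.2) ^ c))) (x, y) =
          (Ioo (0:ℝ) (1 - x)).indicator (fun y => ENNReal.ofReal ((2 * π)⁻¹ * x ^ (a - 1/2)) *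
            ENNReal.ofReal (y ^ (b + 1/2 - 1) * (1 - x - y) ^ (c + 1/2 - 1))) y := by
        intro y
        by_cases hy : y ∈ Ioo (0:ℝ) (1 - x)
        · have hy0 : 0 < y := hy.1
          have hz : 0 < 1 - x - y := by linarith [hy.2]
          rw [Set.indicator_of_mem hy, Pi.mul_apply, Set.indicator_of_mem
            (show (x, y) ∈ {q : ℝ × ℝ | 0 < q.1 ∧ 0 < q.2 ∧ q.1 + q.2 < 1} from
              ⟨hx0, hy0, by simp only; linarith⟩)]
          simp only
          rw [← ENNReal.ofReal_mul (by positivity), ← ENNReal.ofReal_mul (by positivity)]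
          congr 1
          rw [Real.mul_rpow (by positivity) hz.le, Real.mul_rpow hx0.le hy0.le,
            show a - 1/2 = -(1/2) + a by ring, show b + 1/2 - 1 = -(1/2) + b by ring,
            show c + 1/2 - 1 = -(1/2) + c by ring, Real.rpow_add hx0, Real.rpow_add hy0,
            Real.rpow_add hz]
          ring
        · rw [Set.indicator_of_notMem hy, Pi.mul_apply, Set.indicator_of_notMem]
          · simp
          · rintro ⟨_, h, h'⟩
            exact hy ⟨h, by simp only at h'; linarith⟩
      simp_rw [h2]
      rw [lintegral_indicator measurableSet_Ioo, lintegral_const_mul _ (by fun_prop), h1,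
        ← ENNReal.ofReal_mul (by positivity), ← ENNReal.ofReal_mul (by positivity)]
      congr 1
      rw [show a + 1/2 - 1 = a - 1/2 by ring,
        show b + 1/2 + (c + 1/2) - 1 = b + c + 1 - 1 by ring]
      ring
    · rw [Set.indicator_of_notMem hx]
      apply (lintegral_congr _).trans lintegral_zero
      intro y
      rw [Pi.mul_apply, Set.indicator_of_notMem]
      · simp
      · rintro ⟨h0, h, h'⟩
        simp only at h0 h h'
        exact hx ⟨h0, by linarith⟩
  simp_rw [key]
  have hB := beta_pos (show 0 < b + 1/2 by positivity) (show 0 < c + 1/2 by positivity)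
  rw [lintegral_indicator measurableSet_Ioo, lintegral_const_mul _ (by fun_prop),
    beta_lintegral (by positivity) (by positivity), ← ENNReal.ofReal_mul (by positivity)]
  congr 1
  unfold beta DM
  have h1 := Real.Gamma_pos_of_pos (s := b + c + 1) (by positivity)
  rw [show b + 1/2 + (c + 1/2) = b + c + 1 by ring,
    show a + 1/2 + (b + c + 1) = a + b + c + 3/2 by ring]
  field_simp

/-- Index of the interval containing `u`. -/
noncomputable def cls (p : ℝ × ℝ) (u : ℝ) : Fin 3 :=
  if u < p.1 then 0 else if u < p.1 + p.2 then 1 else 2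

lemma unif_cls {p : ℝ × ℝ} (h1 : 0 < p.1) (h2 : 0 < p.2) (h3 : p.1 + p.2 < 1)
    (G : Fin 3 → ℝ≥0∞) :
    ∫⁻ u, G (cls p u) ∂unif01 = ENNReal.ofReal p.1 * G 0 + ENNReal.ofReal p.2 * G 1 +
      ENNReal.ofReal (1 - p.1 - p.2) * G 2 := by
  have hs : Icc (0:ℝ) 1 = Ico 0 p.1 ∪ (Ico p.1 (p.1 + p.2) ∪ Icc (p.1 + p.2) 1) := by
    rw [Ico_union_Icc_eq_Icc (by linarith) (by linarith),
      Ico_union_Icc_eq_Icc (by linarith) (by linarith)]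
  unfold unif01
  rw [hs, lintegral_union (measurableSet_Ico.union measurableSet_Icc),
    lintegral_union measurableSet_Icc]
  · have e1 : ∫⁻ u in Ico 0 p.1, G (cls p u) = ∫⁻ u in Ico 0 p.1, G 0 := by
      apply setLIntegral_congr_fun measurableSet_Ico
      intro u hu
      simp [cls, hu.2]
    have e2 : ∫⁻ u in Ico p.1 (p.1 + p.2), G (cls p u) = ∫⁻ u in Ico p.1 (p.1 + p.2), G 1 := by
      apply setLIntegral_congr_fun measurableSet_Ico
      intro u hu
      simp [cls, hu.2, hu.1.not_gt]
    have e3 : ∫⁻ u in Icc (p.1 + p.2) 1, G (cls p u) = ∫⁻ u in Icc (p.1 + p.2) 1, G 2 := by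
      apply setLIntegral_congr_fun measurableSet_Icc
      intro u hu
      have : ¬ u < p.1 := by linarith [hu.1]
      simp [cls, hu.1.not_gt, this]
    rw [e1, e2, e3]
    simp only [setLIntegral_const, Real.volume_Ico, Real.volume_Icc]
    rw [sub_zero, show p.1 + p.2 - p.1 = p.2 by ring, show 1 - (p.1 + p.2) = 1 - p.1 - p.2 by ring]
    ring
  · rw [Set.disjoint_left]
    intro u hu hu'
    linarith [hu.2, hu'.1]
  · rw [Ico_union_Icc_eq_Icc (by linarith) (by linarith), Set.disjoint_left]
    intro u hu hu'
    linarith [hu.2, hu'.1]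

noncomputable def W (i j k : Fin 3) : ℝ := if i = k ∨ j = k then 1 else 0

noncomputable def phi (p : ℝ × ℝ) (i j : Fin 3) (d₁ d₂ d₃ : ℝ) : ℝ :=
  √p.1 * d₁ * W i j 0 + √p.2 * d₂ * W i j 1 + √(1 - p.1 - p.2) * d₃ * W i j 2

lemma cls_eq {p : ℝ × ℝ} (h1 : 0 < p.1) (h2 : 0 < p.2) (h3 : p.1 + p.2 < 1) {u : ℝ}
    (hu : u ∈ Icc (0:ℝ) 1) :
    (u ∈ Ico (0:ℝ) p.1 ↔ cls p u = 0) ∧ (u ∈ Ico p.1 (p.1 + p.2) ↔ cls p u = 1) ∧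
      (u ∈ Icc (p.1 + p.2) 1 ↔ cls p u = 2) := by
  unfold cls
  simp only [mem_Ico, mem_Icc] at hu ⊢
  by_cases a : u < p.1
  · have b : u < p.1 + p.2 := by linarith
    simp [a, b, hu, a.not_ge, b.not_ge]
  · by_cases b : u < p.1 + p.2
    · simp [a, b, hu, b.not_ge, not_lt.1 a]
    · simp [a, b, hu, not_lt.1 a, not_lt.1 b]

lemma smoothing_eq {p : ℝ × ℝ} (h1 : 0 < p.1) (h2 : 0 < p.2) (h3 : p.1 + p.2 < 1) {u v : ℝ}
    (hu : u ∈ Icc (0:ℝ) 1) (hv : v ∈ Icc (0:ℝ) 1) (d₁ d₂ d₃ : ℝ) :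
    smoothingMap (p, u, v, d₁, d₂, d₃) = phi p (cls p u) (cls p v) d₁ d₂ d₃ := by
  obtain ⟨a1, a2, a3⟩ := cls_eq h1 h2 h3 hu
  obtain ⟨b1, b2, b3⟩ := cls_eq h1 h2 h3 hv
  simp only [smoothingMap, a1, a2, a3, b1, b2, b3, phi, W]

lemma measurable_smoothing : Measurable smoothingMap := by
  unfold smoothingMap
  have hI : ∀ (f g h : (ℝ × ℝ) × ℝ × ℝ × ℝ × ℝ × ℝ → ℝ), Measurable f → Measurable g →
      Measurable h → MeasurableSet {q | f q ∈ Ico (g q) (h q)} := by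
    intro f g h hf hg hh
    exact (measurableSet_le hg hf).inter (measurableSet_lt hf hh)
  have hI' : ∀ (f g h : (ℝ × ℝ) × ℝ × ℝ × ℝ × ℝ × ℝ → ℝ), Measurable f → Measurable g →
      Measurable h → MeasurableSet {q | f q ∈ Icc (g q) (h q)} := by
    intro f g h hf hg hh
    exact (measurableSet_le hg hf).inter (measurableSet_le hf hh)
  refine Measurable.add (Measurable.add ?_ ?_) ?_
  · refine Measurable.mul (by fun_prop) (Measurable.ite ?_ measurable_const measurable_const)
    exact (hI _ _ _ (by fun_prop) (by fun_prop) (by fun_prop)).union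
      (hI _ _ _ (by fun_prop) (by fun_prop) (by fun_prop))
  · refine Measurable.mul (by fun_prop) (Measurable.ite ?_ measurable_const measurable_const)
    exact (hI _ _ _ (by fun_prop) (by fun_prop) (by fun_prop)).union
      (hI _ _ _ (by fun_prop) (by fun_prop) (by fun_prop))
  · refine Measurable.mul (by fun_prop) (Measurable.ite ?_ measurable_const measurable_const)
    exact (hI' _ _ _ (by fun_prop) (by fun_prop) (by fun_prop)).union
      (hI' _ _ _ (by fun_prop) (by fun_prop) (by fun_prop))

instance : SFinite unif01 := by unfold unif01; infer_instance
instance : SFinite dirichletHalf := by unfold dirichletHalf; infer_instance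

noncomputable def K (n : ℕ) (p : ℝ × ℝ) (i j : Fin 3) : ℝ≥0∞ :=
  ∫⁻ d₁, ∫⁻ d₂, ∫⁻ d₃, ENNReal.ofReal (phi p i j d₁ d₂ d₃) ^ n ∂rayleigh ∂rayleigh ∂rayleigh

lemma Fsm_lintegral (n : ℕ) :
    ∫⁻ x, ENNReal.ofReal x ^ n ∂(Fsm rayleigh) = ∫⁻ p, (∫⁻ u, ∫⁻ v, 
      K n p (cls p u) (cls p v) ∂unif01 ∂unif01) ∂dirichletHalf := by
  unfold Fsm
  have hm := measurable_smoothing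
  rw [lintegral_map (by fun_prop) measurable_smoothing, lintegral_prod _ (by fun_prop)]
  apply lintegral_congr_ae
  filter_upwards [dir_ae] with p hp
  obtain ⟨h1, h2, h3⟩ := hp
  rw [lintegral_prod _ (by fun_prop)]
  apply lintegral_congr_ae
  have hae : ∀ᵐ u ∂unif01, u ∈ Icc (0:ℝ) 1 := ae_restrict_mem measurableSet_Icc
  filter_upwards [hae] with u hu
  rw [lintegral_prod _ (by fun_prop)]
  apply lintegral_congr_ae
  filter_upwards [hae] with v hv
  rw [lintegral_prod _ (by fun_prop)]
  unfold K
  apply lintegral_congr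
  intro d₁
  rw [lintegral_prod _ (by fun_prop)]
  simp_rw [smoothing_eq h1 h2 h3 hu hv]

lemma Fsm_nonneg : ∀ᵐ x ∂(Fsm rayleigh), 0 ≤ x := by
  unfold Fsm
  rw [ae_map_iff measurable_smoothing.aemeasurable measurableSet_Ici]
  have h := rayleigh_ae_pos
  have q1 : ∀ᵐ q ∂(dirichletHalf.prod (unif01.prod (unif01.prod (rayleigh.prod
      (rayleigh.prod rayleigh))))), 0 < q.2.2.2.1 :=
    (Measure.quasiMeasurePreserving_fst.comp (Measure.quasiMeasurePreserving_snd.comp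
      (Measure.quasiMeasurePreserving_snd.comp Measure.quasiMeasurePreserving_snd))).ae h
  have q2 : ∀ᵐ q ∂(dirichletHalf.prod (unif01.prod (unif01.prod (rayleigh.prod
      (rayleigh.prod rayleigh))))), 0 < q.2.2.2.2.1 :=
    (Measure.quasiMeasurePreserving_fst.comp (Measure.quasiMeasurePreserving_snd.comp
      (Measure.quasiMeasurePreserving_snd.comp
      (Measure.quasiMeasurePreserving_snd.comp Measure.quasiMeasurePreserving_snd)))).ae h
  have q3 : ∀ᵐ q ∂(dirichletHalf.prod (unif01.prod (unif01.prod (rayleigh.prod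
      (rayleigh.prod rayleigh))))), 0 < q.2.2.2.2.2 :=
    (Measure.quasiMeasurePreserving_snd.comp (Measure.quasiMeasurePreserving_snd.comp
      (Measure.quasiMeasurePreserving_snd.comp
      (Measure.quasiMeasurePreserving_snd.comp Measure.quasiMeasurePreserving_snd)))).ae h
  filter_upwards [q1, q2, q3] with q a b c
  unfold smoothingMap
  have : ∀ (P : Prop) [Decidable P], (0:ℝ) ≤ if P then 1 else 0 := by
    intro P _; split_ifs <;> norm_num
  refine add_nonneg (add_nonneg ?_ ?_) ?_ <;>
  exact mul_nonneg (by positivity) (this _)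

lemma KA (n : ℕ) {s : ℝ} (hs : 0 ≤ s) :
    ∫⁻ d, ENNReal.ofReal (s * d) ^ n ∂rayleigh = ENNReal.ofReal (s ^ n * Ray n) := by
  simp_rw [ENNReal.ofReal_mul hs, mul_pow]
  rw [lintegral_const_mul _ (by fun_prop), rayleigh_moment, ENNReal.ofReal_mul (by positivity),
    ENNReal.ofReal_pow hs]

noncomputable def CC (n k : ℕ) : ℝ := n.choose k * Ray k * Ray (n - k)

lemma CC_pos (n k : ℕ) : 0 ≤ CC n k := by
  have := Ray_pos k
  have := Ray_pos (n - k)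
  unfold CC; positivity

lemma KB (n : ℕ) {s t : ℝ} (hs : 0 ≤ s) (ht : 0 ≤ t) :
    ∫⁻ d₁, ∫⁻ d₂, ENNReal.ofReal (s * d₁ + t * d₂) ^ n ∂rayleigh ∂rayleigh =
      ∑ k ∈ Finset.range (n + 1), ENNReal.ofReal (CC n k * (s ^ k * t ^ (n - k))) := by
  have h1 : ∀ᵐ d₁ ∂rayleigh, ∫⁻ d₂, ENNReal.ofReal (s * d₁ + t * d₂) ^ n ∂rayleigh =
      ∑ k ∈ Finset.range (n + 1), ENNReal.ofReal (s * d₁) ^ k *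
        ENNReal.ofReal (t ^ (n - k) * Ray (n - k) * n.choose k) := by
    filter_upwards [rayleigh_ae_pos] with d₁ hd₁
    have : ∀ᵐ d₂ ∂rayleigh, ENNReal.ofReal (s * d₁ + t * d₂) ^ n =
        ∑ k ∈ Finset.range (n + 1), ENNReal.ofReal (s * d₁) ^ k *
         (ENNReal.ofReal (t * d₂) ^ (n - k) * n.choose k) := by
      filter_upwards [rayleigh_ae_pos] with d₂ hd₂
      rw [ENNReal.ofReal_add (by positivity) (by positivity), add_pow]
      simp_rw [mul_assoc]
    rw [lintegral_congr_ae this, lintegral_finsetSum _ (fun k _ => by fun_prop)]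
    apply Finset.sum_congr rfl
    intro k _
    have := Ray_pos (n - k)
    rw [lintegral_const_mul _ (by fun_prop), lintegral_mul_const _ (by fun_prop), KA _ ht,
      ENNReal.ofReal_mul (q := (n.choose k : ℝ)) (by positivity), ENNReal.ofReal_natCast]
  rw [lintegral_congr_ae h1, lintegral_finsetSum _ (fun k _ => by fun_prop)]
  apply Finset.sum_congr rfl
  intro k _
  have := Ray_pos k
  rw [lintegral_mul_const _ (by fun_prop), KA _ hs, ← ENNReal.ofReal_mul (by positivity)]
  congr 1
  unfold CC
  ring

noncomputable def KD (n : ℕ) (s : ℝ) : ℝ≥0∞ := ENNReal.ofReal (Ray n * √s ^ n)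
noncomputable def KO (n : ℕ) (s t : ℝ) : ℝ≥0∞ :=
  ∑ k ∈ Finset.range (n + 1), ENNReal.ofReal (CC n k * (√s ^ k * √t ^ (n - k)))

lemma K_values (n : ℕ) (p : ℝ × ℝ) :
    K n p 0 0 = KD n p.1 ∧ K n p 1 1 = KD n p.2 ∧ K n p 2 2 = KD n (1 - p.1 - p.2) ∧
    K n p 0 1 = KO n p.1 p.2 ∧ K n p 1 0 = KO n p.1 p.2 ∧
    K n p 0 2 = KO n p.1 (1 - p.1 - p.2) ∧ K n p 2 0 = KO n p.1 (1 - p.1 - p.2) ∧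
    K n p 1 2 = KO n p.2 (1 - p.1 - p.2) ∧ K n p 2 1 = KO n p.2 (1 - p.1 - p.2) := by
  have hA := fun s : ℝ => KA n (Real.sqrt_nonneg s)
  have hB := fun s t : ℝ => KB n (Real.sqrt_nonneg s) (Real.sqrt_nonneg t)
  refine ⟨?_, ?_, ?_, ?_, ?_, ?_, ?_, ?_, ?_⟩ <;>
  simp [K, phi, W, KD, KO, hA, hB, mul_comm (Ray n), -ENNReal.ofReal_mul]

lemma Fsm_lintegral2 (n : ℕ) :
    ∫⁻ x, ENNReal.ofReal x ^ n ∂(Fsm rayleigh) = ∫⁻ p, (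
      (ENNReal.ofReal p.1 * (ENNReal.ofReal p.1 * KD n p.1)
      + ENNReal.ofReal p.2 * (ENNReal.ofReal p.2 * KD n p.2)
      + ENNReal.ofReal (1 - p.1 - p.2) * (ENNReal.ofReal (1 - p.1 - p.2) * KD n (1 - p.1 - p.2)))
      + (2 * (ENNReal.ofReal p.1 * (ENNReal.ofReal p.2 * KO n p.1 p.2))
      + 2 * (ENNReal.ofReal p.1 * (ENNReal.ofReal (1 - p.1 - p.2) * KO n p.1 (1 - p.1 - p.2)))
      + 2 * (ENNReal.ofReal p.2 * (ENNReal.ofReal (1 - p.1 - p.2) * KO n p.2 (1 - p.1 - p.2)))))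
      ∂dirichletHalf := by
  rw [Fsm_lintegral]
  apply lintegral_congr_ae
  filter_upwards [dir_ae] with p hp
  obtain ⟨h1, h2, h3⟩ := hp
  have e : ∀ i, ∫⁻ v, K n p i (cls p v) ∂unif01 = _ := fun i => unif_cls h1 h2 h3 (K n p i)
  simp_rw [e]
  rw [unif_cls h1 h2 h3 (fun i => ENNReal.ofReal p.1 * K n p i 0 + ENNReal.ofReal p.2 * K n p i 1 +
      ENNReal.ofReal (1 - p.1 - p.2) * K n p i 2)]
  obtain ⟨a1, a2, a3, a4, a5, a6, a7, a8, a9⟩ := K_values n p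
  rw [a1, a2, a3, a4, a5, a6, a7, a8, a9]
  ring

lemma dup (k : ℕ) : Real.Gamma (k/2 + 1) * Real.Gamma (k/2 + 1 + 1/2) =
    (k+1).factorial * ((2:ℝ)^(k+1))⁻¹ * √π := by
  have h := Real.Gamma_mul_Gamma_add_half ((k:ℝ)/2 + 1)
  rw [h, show 2 * ((k:ℝ)/2 + 1) = ((k+1 : ℕ) : ℝ) + 1 by push_cast; ring,
    Real.Gamma_nat_eq_factorial, show 1 - (((k+1 : ℕ) : ℝ) + 1) = -((k+1 : ℕ) : ℝ) by ring,
    Real.rpow_neg (by norm_num), Real.rpow_natCast]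

lemma poly_sum (m : ℕ) (c : ℝ) : ∑ k ∈ Finset.range m, ((k:ℝ) + 1) * (c - k + 1) =
    (c + 1) * m * (m + 1) / 2 - (m - 1) * m * (m + 1) / 3 := by
  induction m with
  | zero => simp
  | succ m ih => rw [Finset.sum_range_succ, ih]; push_cast; ring

lemma term_eq {n k : ℕ} (hk : k ≤ n) :
    CC n k * DM ((k:ℝ)/2 + 1) (((n - k : ℕ) : ℝ)/2 + 1) 0 =
      (((k:ℝ) + 1) * ((n:ℝ) - k + 1)) *
      (2 ^ ((n:ℝ)/2) * n.factorial * ((2:ℝ)^(n+3))⁻¹ * √π / Real.Gamma (n/2 + 7/2)) := by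
  obtain ⟨l, rfl⟩ := Nat.exists_eq_add_of_le hk
  rw [Nat.add_sub_cancel_left]
  have d1 := dup k
  have d2 := dup l
  have hc : ((k + l).choose k : ℝ) * k.factorial * l.factorial = (k+l).factorial := by
    have := Nat.add_choose_mul_factorial_mul_factorial k l
    rw [← Nat.choose_symm_add] at this
    exact_mod_cast this
  have hG := Real.Gamma_pos_of_pos (s := ((k + l : ℕ):ℝ)/2 + 7/2) (by positivity)
  have hpi : √π * √π = π := Real.mul_self_sqrt Real.pi_pos.le
  have hpos := Real.pi_pos
  rw [← hc]
  calc CC (k + l) k * DM ((k:ℝ)/2 + 1) ((l : ℝ)/2 + 1) 0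
      = ((k + l).choose k) * (2 ^ ((k:ℝ)/2) * 2 ^ ((l:ℝ)/2)) *
        (Real.Gamma (k/2 + 1) * Real.Gamma (k/2 + 1 + 1/2)) *
        (Real.Gamma (l/2 + 1) * Real.Gamma (l/2 + 1 + 1/2)) * (2 * π)⁻¹ * √π
          / Real.Gamma (((k + l : ℕ):ℝ)/2 + 7/2) := by
        unfold CC DM Ray
        rw [Nat.add_sub_cancel_left, zero_add, Real.Gamma_one_half_eq,
          show (k:ℝ)/2 + 1 + ((l:ℝ)/2 + 1) + 0 + 3/2 = ((k + l : ℕ):ℝ)/2 + 7/2 by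
            push_cast; ring]
        ring
    _ = _ := by
        rw [d1, d2, ← Real.rpow_add (by norm_num),
          show (k:ℝ)/2 + (l:ℝ)/2 = ((k + l : ℕ):ℝ)/2 by push_cast; ring]
        rw [Nat.factorial_succ, Nat.factorial_succ]
        generalize (2:ℝ) ^ (((k + l : ℕ):ℝ)/2) = A at *
        generalize Real.Gamma (((k + l : ℕ):ℝ)/2 + 7/2) = B at *
        push_cast
        generalize hq : √π = q at *
        rw [← hpi]
        have hq0 : q ≠ 0 := by rintro rfl; simp at hpi; exact hpos.ne hpi
        field_simp
        ring

lemma sum_terms (n : ℕ) :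
    ∑ k ∈ Finset.range (n + 1), CC n k * DM ((k:ℝ)/2 + 1) (((n - k : ℕ) : ℝ)/2 + 1) 0 =
      Ray n * ((n/2 + 1) / (n/2 + 5/2)) / 6 := by
  rw [Finset.sum_congr rfl (fun k hk => term_eq (Nat.lt_succ_iff.1 (Finset.mem_range.1 hk))),
    ← Finset.sum_mul, poly_sum]
  have d := dup (n + 2)
  rw [show (((n + 2 : ℕ) : ℝ))/2 + 1 + 1/2 = (n:ℝ)/2 + 5/2 by push_cast; ring,
    show (((n + 2 : ℕ) : ℝ))/2 + 1 = (n:ℝ)/2 + 1 + 1 by push_cast; ring,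
    Real.Gamma_add_one (s := (n:ℝ)/2 + 1) (by positivity)] at d
  rw [show (n:ℝ)/2 + 7/2 = (n:ℝ)/2 + 5/2 + 1 by ring,
    Real.Gamma_add_one (s := (n:ℝ)/2 + 5/2) (by positivity)]
  have hG := Real.Gamma_pos_of_pos (s := (n:ℝ)/2 + 5/2) (by positivity)
  have hG1 := Real.Gamma_pos_of_pos (s := (n:ℝ)/2 + 1) (by positivity)
  have hf : (((n + 2 + 1).factorial : ℕ) : ℝ) = (n+3) * ((n+2) * ((n+1) * n.factorial)) := by
    rw [Nat.factorial_succ, Nat.factorial_succ, Nat.factorial_succ]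
    push_cast; ring
  rw [hf] at d
  unfold Ray
  have d' : (n.factorial : ℝ) * ((2:ℝ)^(n+3))⁻¹ * √π = ((n:ℝ)/2 + 1) * Real.Gamma (n/2 + 1) *
      Real.Gamma (n/2 + 5/2) / ((n+3) * ((n+2) * (n+1))) := by
    rw [d]; field_simp
  rw [show (2:ℝ) ^ ((n:ℝ)/2) * n.factorial * ((2:ℝ)^(n+3))⁻¹ * √π =
    2 ^ ((n:ℝ)/2) * (n.factorial * ((2:ℝ)^(n+3))⁻¹ * √π) by ring, d']
  have : (n:ℝ)/2 + 5/2 ≠ 0 := by positivity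
  push_cast
  field_simp
  ring

lemma diag_term (n : ℕ) : DM ((n:ℝ)/2 + 2) 0 0 = 1 / (2 * (n/2 + 5/2)) := by
  unfold DM
  rw [zero_add, Real.Gamma_one_half_eq,
    show (n:ℝ)/2 + 2 + 1/2 = n/2 + 5/2 by ring, show (n:ℝ)/2 + 2 + 0 + 0 + 3/2 = n/2 + 5/2 + 1 by ring,
    Real.Gamma_add_one (s := (n:ℝ)/2 + 5/2) (by positivity)]
  have hG := Real.Gamma_pos_of_pos (s := (n:ℝ)/2 + 5/2) (by positivity)
  have hpi : √π * √π = π := Real.mul_self_sqrt Real.pi_pos.le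
  have hpos := Real.pi_pos
  rw [mul_assoc (Real.Gamma _), hpi]
  field_simp

lemma moment_identity (n : ℕ) :
    3 * (Ray n * DM ((n:ℝ)/2 + 2) 0 0) + 3 * (2 * ∑ k ∈ Finset.range (n + 1),
      CC n k * DM ((k:ℝ)/2 + 1) (((n - k : ℕ) : ℝ)/2 + 1) 0) = Ray n := by
  rw [sum_terms, diag_term]
  field_simp
  ring

lemma DM_swap12 (a b c : ℝ) : DM a b c = DM b a c := by
  unfold DM; rw [add_comm a b, mul_comm (Real.Gamma (a + 1/2))]

lemma DM_swap23 (a b c : ℝ) : DM a b c = DM a c b := by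
  unfold DM; rw [add_right_comm a b c, mul_right_comm (Real.Gamma (a + 1/2))]

lemma dir_term {a b c r : ℝ} (ha : 0 ≤ a) (hb : 0 ≤ b) (hc : 0 ≤ c) (hr : 0 ≤ r) :
    ∫⁻ p, ENNReal.ofReal (r * (p.1 ^ a * p.2 ^ b * (1 - p.1 - p.2) ^ c)) ∂dirichletHalf =
      ENNReal.ofReal (r * DM a b c) := by
  simp_rw [ENNReal.ofReal_mul hr]
  rw [lintegral_const_mul _ (by fun_prop), dir_moment ha hb hc]

lemma pow_half {x : ℝ} (hx : 0 < x) (k : ℕ) : √x ^ k = x ^ ((k:ℝ)/2) := by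
  rw [Real.sqrt_eq_rpow, ← Real.rpow_natCast, ← Real.rpow_mul hx.le]
  congr 1; ring

lemma diag_conv {x : ℝ} (hx : 0 < x) (n : ℕ) :
    ENNReal.ofReal x * (ENNReal.ofReal x * KD n x) =
      ENNReal.ofReal (Ray n * x ^ ((n:ℝ)/2 + 2)) := by
  unfold KD
  rw [← ENNReal.ofReal_mul hx.le, ← ENNReal.ofReal_mul hx.le, pow_half hx, Real.rpow_add hx,
    Real.rpow_two]
  congr 1; ring

lemma off_conv {x y : ℝ} (hx : 0 < x) (hy : 0 < y) (n : ℕ) :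
    ENNReal.ofReal x * (ENNReal.ofReal y * KO n x y) =
      ∑ k ∈ Finset.range (n + 1), ENNReal.ofReal (CC n k *
        (x ^ ((k:ℝ)/2 + 1) * y ^ (((n - k : ℕ) : ℝ)/2 + 1))) := by
  unfold KO
  rw [Finset.mul_sum, Finset.mul_sum]
  apply Finset.sum_congr rfl
  intro k _
  rw [← ENNReal.ofReal_mul hy.le, ← ENNReal.ofReal_mul hx.le, pow_half hx, pow_half hy,
    Real.rpow_add hx, Real.rpow_add hy, Real.rpow_one, Real.rpow_one]
  congr 1; ring

lemma measurable_KD (n : ℕ) : Measurable (KD n) := by unfold KD; fun_prop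

lemma measurable_KO (n : ℕ) {f g : ℝ × ℝ → ℝ} (hf : Measurable f) (hg : Measurable g) :
    Measurable (fun p => KO n (f p) (g p)) := by unfold KO; fun_prop

lemma dir_diag (n : ℕ) :
    (∫⁻ p, ENNReal.ofReal p.1 * (ENNReal.ofReal p.1 * KD n p.1) ∂dirichletHalf
      = ENNReal.ofReal (Ray n * DM ((n:ℝ)/2 + 2) 0 0)) ∧
    (∫⁻ p, ENNReal.ofReal p.2 * (ENNReal.ofReal p.2 * KD n p.2) ∂dirichletHalf
      = ENNReal.ofReal (Ray n * DM ((n:ℝ)/2 + 2) 0 0)) ∧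
    (∫⁻ p, ENNReal.ofReal (1 - p.1 - p.2) *
      (ENNReal.ofReal (1 - p.1 - p.2) * KD n (1 - p.1 - p.2)) ∂dirichletHalf
      = ENNReal.ofReal (Ray n * DM ((n:ℝ)/2 + 2) 0 0)) := by
  have hn : 0 ≤ (n:ℝ)/2 + 2 := by positivity
  refine ⟨?_, ?_, ?_⟩
  · rw [← dir_term hn le_rfl le_rfl (Ray_pos n).le]
    apply lintegral_congr_ae
    filter_upwards [dir_ae] with p ⟨h1, h2, h3⟩
    rw [diag_conv h1]; simp
  · rw [DM_swap12, ← dir_term le_rfl hn le_rfl (Ray_pos n).le]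
    apply lintegral_congr_ae
    filter_upwards [dir_ae] with p ⟨h1, h2, h3⟩
    rw [diag_conv h2]; simp
  · rw [DM_swap12, DM_swap23, ← dir_term le_rfl le_rfl hn (Ray_pos n).le]
    apply lintegral_congr_ae
    filter_upwards [dir_ae] with p ⟨h1, h2, h3⟩
    rw [diag_conv (by linarith)]; simp

lemma dir_off (n : ℕ) :
    (∫⁻ p, ENNReal.ofReal p.1 * (ENNReal.ofReal p.2 * KO n p.1 p.2) ∂dirichletHalf
      = ENNReal.ofReal (∑ k ∈ Finset.range (n + 1),
        CC n k * DM ((k:ℝ)/2 + 1) (((n - k : ℕ) : ℝ)/2 + 1) 0)) ∧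
    (∫⁻ p, ENNReal.ofReal p.1 * (ENNReal.ofReal (1 - p.1 - p.2) *
      KO n p.1 (1 - p.1 - p.2)) ∂dirichletHalf
      = ENNReal.ofReal (∑ k ∈ Finset.range (n + 1),
        CC n k * DM ((k:ℝ)/2 + 1) (((n - k : ℕ) : ℝ)/2 + 1) 0)) ∧
    (∫⁻ p, ENNReal.ofReal p.2 * (ENNReal.ofReal (1 - p.1 - p.2) *
      KO n p.2 (1 - p.1 - p.2)) ∂dirichletHalf
      = ENNReal.ofReal (∑ k ∈ Finset.range (n + 1),
        CC n k * DM ((k:ℝ)/2 + 1) (((n - k : ℕ) : ℝ)/2 + 1) 0)) := by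
  have hn : ∀ k : ℕ, 0 ≤ (k:ℝ)/2 + 1 := fun k => by positivity
  rw [ENNReal.ofReal_sum_of_nonneg
    (fun k _ => mul_nonneg (CC_pos n k) (DM_pos (hn k) (hn (n-k)) le_rfl).le)]
  refine ⟨?_, ?_, ?_⟩
  · rw [Finset.sum_congr rfl
      (fun k _ => (dir_term (hn k) (hn (n-k)) le_rfl (CC_pos n k)).symm),
      ← lintegral_finsetSum _ (fun k _ => by fun_prop)]
    apply lintegral_congr_ae
    filter_upwards [dir_ae] with p ⟨h1, h2, h3⟩
    rw [off_conv h1 h2]; simp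
  · simp_rw [fun k : ℕ => DM_swap23 ((k:ℝ)/2 + 1)]
    rw [Finset.sum_congr rfl
      (fun k _ => (dir_term (hn k) le_rfl (hn (n-k)) (CC_pos n k)).symm),
      ← lintegral_finsetSum _ (fun k _ => by fun_prop)]
    apply lintegral_congr_ae
    filter_upwards [dir_ae] with p ⟨h1, h2, h3⟩
    rw [off_conv h1 (by linarith)]; simp
  · have hsw : ∀ a b : ℝ, DM a b 0 = DM 0 a b := fun a b => by rw [DM_swap23, DM_swap12]
    simp_rw [hsw]
    rw [Finset.sum_congr rfl
      (fun k _ => (dir_term le_rfl (hn k) (hn (n-k)) (CC_pos n k)).symm),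
      ← lintegral_finsetSum _ (fun k _ => by fun_prop)]
    apply lintegral_congr_ae
    filter_upwards [dir_ae] with p ⟨h1, h2, h3⟩
    rw [off_conv h2 (by linarith)]; simp

lemma Fsm_moment (n : ℕ) :
    ∫⁻ x, ENNReal.ofReal x ^ n ∂(Fsm rayleigh) = ∫⁻ x, ENNReal.ofReal x ^ n ∂rayleigh := by
  rw [Fsm_lintegral2, rayleigh_moment]
  obtain ⟨a1, a2, a3⟩ := dir_diag n
  obtain ⟨b1, b2, b3⟩ := dir_off n
  have hKD := measurable_KD n
  have m1 := measurable_KO n (f := fun p => p.1) (g := fun p => p.2) (by fun_prop) (by fun_prop)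
  have m2 := measurable_KO n (f := fun p => p.1) (g := fun p => 1 - p.1 - p.2)
    (by fun_prop) (by fun_prop)
  have m3 := measurable_KO n (f := fun p => p.2) (g := fun p => 1 - p.1 - p.2)
    (by fun_prop) (by fun_prop)
  rw [lintegral_add_left (by fun_prop), lintegral_add_left (by fun_prop),
    lintegral_add_left (by fun_prop), lintegral_add_left (by fun_prop),
    lintegral_add_left (by fun_prop), lintegral_const_mul _ (by fun_prop),
    lintegral_const_mul _ (by fun_prop), lintegral_const_mul _ (by fun_prop),
    a1, a2, a3, b1, b2, b3]
  have hn : ∀ k : ℕ, 0 ≤ (k:ℝ)/2 + 1 := fun k => by positivity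
  have p1 : 0 ≤ Ray n * DM ((n:ℝ)/2 + 2) 0 0 :=
    mul_nonneg (Ray_pos n).le (DM_pos (by positivity) le_rfl le_rfl).le
  have p2 : 0 ≤ ∑ k ∈ Finset.range (n + 1),
      CC n k * DM ((k:ℝ)/2 + 1) (((n - k : ℕ) : ℝ)/2 + 1) 0 :=
    Finset.sum_nonneg
      (fun k _ => mul_nonneg (CC_pos n k) (DM_pos (hn k) (hn (n-k)) le_rfl).le)
  conv_rhs => rw [← moment_identity n]
  generalize Ray n * DM ((n:ℝ)/2 + 2) 0 0 = A at *
  generalize ∑ k ∈ Finset.range (n + 1),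
      CC n k * DM ((k:ℝ)/2 + 1) (((n - k : ℕ) : ℝ)/2 + 1) 0 = B at *
  rw [ENNReal.ofReal_add (by positivity) (by positivity), ENNReal.ofReal_mul (p := 3) (by norm_num),
    ENNReal.ofReal_mul (p := 3) (by norm_num), ENNReal.ofReal_mul (p := 2) (by norm_num),
    ENNReal.ofReal_ofNat, ENNReal.ofReal_ofNat]
  ring

/-- The Rayleigh distribution is a fixed point of the smoothing transform `𝔉_sm`. -/
theorem rayleigh_fixed_point_of_smoothing : Fsm rayleigh = rayleigh := by
  exact rayleigh_determinate _ Fsm_nonneg Fsm_moment
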